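/- Let φ = C_1 ∧ … ∧ C_m be a CNF formula over variables V and F_φ its standard translation. For every truth assignment θ over V with θ ⊭ φ, the set of arguments θ ∪ { C_i | θ ⊭ C_i } (the literal arguments true under θ together with the clause arguments of all clauses falsified by θ) is both a stable extension and a complete extension of F_φ. -/

import Mathlib

def conflictFree {α : Type*} (A : Set α) (R : Set (α × α)) (E : Set α) : Prop :=
  E ⊆ A ∧ ∀ x ∈ E, ∀ y ∈ E, (x, y) ∉ R

def defended {α : Type*} (R : Set (α × α)) (E : Set α) (x : α) : Prop :=
  ∀ y, (y, x) ∈ R → ∃ z ∈ E, (z, y) ∈ R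

def admissible {α : Type*} (A : Set α) (R : Set (α × α)) (E : Set α) : Prop :=
  conflictFree A R E ∧ ∀ x ∈ E, defended R E x

def stable {α : Type*} (A : Set α) (R : Set (α × α)) (E : Set α) : Prop :=
  conflictFree A R E ∧ ∀ x ∈ A, x ∉ E → ∃ y ∈ E, (y, x) ∈ R

def naive {α : Type*} (A : Set α) (R : Set (α × α)) (E : Set α) : Prop :=
  conflictFree A R E ∧ ∀ E', E ⊂ E' → ¬ conflictFree A R E'

def preferred {α : Type*} (A : Set α) (R : Set (α × α)) (E : Set α) : Prop :=
  admissible A R E ∧ ∀ E', E ⊂ E' → ¬ admissible A R E'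

def complete {α : Type*} (A : Set α) (R : Set (α × α)) (E : Set α) : Prop :=
  admissible A R E ∧ ∀ x ∈ A, defended R E x → x ∈ E

def credAccepted {α : Type*} (σ : Set α → Prop) (x : α) : Prop :=
  ∃ E, σ E ∧ x ∈ E

def isFacet {α : Type*} (σ : Set α → Prop) (x : α) : Prop :=
  (∃ E, σ E ∧ x ∈ E) ∧ ¬ ∀ E, σ E → x ∈ E

/-- A literal over variables `V`: a variable or its negation. -/
inductive Lit (V : Type*) where
  | pos (x : V)
  | neg (x : V)
deriving DecidableEq

/-- The complement of a literal. -/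
def Lit.compl {V : Type*} : Lit V → Lit V
  | .pos x => .neg x
  | .neg x => .pos x

/-- Evaluation of a literal under a truth assignment. -/
def Lit.eval {V : Type*} (θ : V → Bool) : Lit V → Bool
  | .pos x => θ x
  | .neg x => !θ x

/-- An assignment satisfies a clause (a finite set of literals). -/
def satClause {V : Type*} (θ : V → Bool) (c : Finset (Lit V)) : Prop :=
  ∃ ℓ ∈ c, Lit.eval θ ℓ = true

/-- An assignment satisfies a CNF with clauses `C 0, …, C (m-1)`. -/
def satCNF {V : Type*} {m : ℕ} (θ : V → Bool) (C : Fin m → Finset (Lit V)) : Prop :=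
  ∀ i, satClause θ (C i)

/-- The arguments of the standard translation `F_φ`: the formula argument,
one argument per clause, and one argument per literal. -/
inductive Arg (V : Type*) (m : ℕ) where
  | fm
  | clause (i : Fin m)
  | lit (ℓ : Lit V)

/-- The attack relation of the standard translation `F_φ`. -/
def attacksOf {V : Type*} {m : ℕ} (C : Fin m → Finset (Lit V)) :
    Set (Arg V m × Arg V m) :=
  {p | (∃ i : Fin m, p = (Arg.clause i, Arg.fm)) ∨
       (∃ ℓ : Lit V, p = (Arg.lit ℓ, Arg.lit ℓ.compl)) ∨
       (∃ i : Fin m, ∃ ℓ ∈ C i, p = (Arg.lit ℓ, Arg.clause i))}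

/-- The set of literal arguments made true by the assignment `θ`. -/
def thetaArgs {V : Type*} (m : ℕ) (θ : V → Bool) : Set (Arg V m) :=
  {x | ∃ ℓ : Lit V, Lit.eval θ ℓ = true ∧ x = Arg.lit ℓ}

/-- If `θ` falsifies `φ`, then the literal arguments true under `θ` together with
the clause arguments of clauses falsified by `θ` form a stable and complete
extension of `F_φ`. -/
theorem falsifying_assignment_stable_complete {V : Type*} [Fintype V] [DecidableEq V]
    {m : ℕ} (C : Fin m → Finset (Lit V)) (θ : V → Bool) (hθ : ¬ satCNF θ C) :
    stable Set.univ (attacksOf C)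
      (thetaArgs m θ ∪ {x : Arg V m | ∃ i, ¬ satClause θ (C i) ∧ x = Arg.clause i}) ∧
    complete Set.univ (attacksOf C)
      (thetaArgs m θ ∪ {x : Arg V m | ∃ i, ¬ satClause θ (C i) ∧ x = Arg.clause i}) := by
  have hev : ∀ ℓ : Lit V, Lit.eval θ ℓ.compl = !Lit.eval θ ℓ := by
    intro ℓ; cases ℓ <;> simp [Lit.eval, Lit.compl]
  have hcc : ∀ ℓ : Lit V, ℓ.compl.compl = ℓ := by
    intro ℓ; cases ℓ <;> rfl
  have key : ∀ (E : Set (Arg V m)), stable Set.univ (attacksOf C) E →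
      complete Set.univ (attacksOf C) E := by
    rintro E ⟨hcf, hst⟩
    refine ⟨⟨hcf, ?_⟩, ?_⟩
    · intro x hx y hyx
      exact hst y trivial (fun hy => hcf.2 y hy x hx hyx)
    · intro x _ hd
      by_contra hx
      obtain ⟨y, hy, hyx⟩ := hst x trivial hx
      obtain ⟨z, hz, hzy⟩ := hd y hyx
      exact hcf.2 z hz y hy hzy
  suffices h : stable Set.univ (attacksOf C)
      (thetaArgs m θ ∪ {x : Arg V m | ∃ i, ¬ satClause θ (C i) ∧ x = Arg.clause i}) from
    ⟨h, key _ h⟩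
  refine ⟨⟨Set.subset_univ _, ?_⟩, ?_⟩
  · rintro x hx y hy (⟨i, h⟩ | ⟨ℓ, h⟩ | ⟨i, ℓ, hℓ, h⟩)
    · obtain ⟨rfl, rfl⟩ := Prod.mk.inj h
      rcases hy with ⟨_, _, h⟩ | ⟨_, _, h⟩ <;> cases h
    · obtain ⟨rfl, rfl⟩ := Prod.mk.inj h
      rcases hx with ⟨a, ha, h1⟩ | ⟨_, _, h1⟩
      · rcases hy with ⟨b, hb, h2⟩ | ⟨_, _, h2⟩
        · injection h1 with h1
          injection h2 with h2
          subst h1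
          rw [← h2, hev, ha] at hb
          cases hb
        · cases h2
      · cases h1
    · obtain ⟨rfl, rfl⟩ := Prod.mk.inj h
      rcases hx with ⟨a, ha, h1⟩ | ⟨_, _, h1⟩
      · rcases hy with ⟨b, hb, h2⟩ | ⟨j, hj, h2⟩
        · cases h2
        · injection h1 with h1
          injection h2 with h2
          subst h1 h2
          exact hj ⟨_, hℓ, ha⟩
      · cases h1
  · intro x _ hx
    cases x with
    | fm =>
      obtain ⟨i, hi⟩ := not_forall.mp hθ
      exact ⟨_, Or.inr ⟨i, hi, rfl⟩, Or.inl ⟨i, rfl⟩⟩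
    | clause i =>
      have hi : satClause θ (C i) := by
        by_contra hi
        exact hx (Or.inr ⟨i, hi, rfl⟩)
      obtain ⟨ℓ, hℓ, he⟩ := hi
      exact ⟨_, Or.inl ⟨ℓ, he, rfl⟩, Or.inr (Or.inr ⟨i, ℓ, hℓ, rfl⟩)⟩
    | lit ℓ =>
      have he : Lit.eval θ ℓ = false := by
        by_contra he
        exact hx (Or.inl ⟨ℓ, by simpa using he, rfl⟩)
      exact ⟨_, Or.inl ⟨ℓ.compl, by simp [hev, he], rfl⟩,
        Or.inr (Or.inl ⟨ℓ.compl, by rw [hcc]⟩)⟩
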